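/- arXiv:1501.04289 — 2 statements merged into one kernel-verified Lean document; each statement's English description precedes it below -/
import Mathlib

section
/- Let ε ∈ (0, σ₀/4) and x ∈ X. Then for every y ∈ 𝒫'_ε(x) there exists a unique pair (s,u) ∈ (−ε,ε) × (−ε,ε) such that y = Γ(g b_s c_u) for any g ∈ G with x = Γg; in particular the pair (s,u) does not depend on the choice of the representative g. -/
noncomputable section

open Real

abbrev SL2 : Type := Matrix.SpecialLinearGroup (Fin 2) ℝ
abbrev PSL2 : Type := SL2 ⧸ Subgroup.center SL2

def projSL : SL2 →* PSL2 := QuotientGroup.mk' (Subgroup.center SL2)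

def Amat (t : ℝ) : SL2 :=
  ⟨!![Real.exp (t / 2), 0; 0, Real.exp (-(t / 2))], by
    simp [Matrix.det_fin_two_of, ← Real.exp_add]⟩

def Bmat (t : ℝ) : SL2 :=
  ⟨!![1, t; 0, 1], by simp [Matrix.det_fin_two_of]⟩

def Cmat (t : ℝ) : SL2 :=
  ⟨!![1, 0; t, 1], by simp [Matrix.det_fin_two_of]⟩

def Dmat : SL2 :=
  ⟨!![0, 1; -1, 0], by norm_num [Matrix.det_fin_two_of]⟩

def aflow (t : ℝ) : PSL2 := projSL (Amat t)
def bhor (t : ℝ) : PSL2 := projSL (Bmat t)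
def chor (t : ℝ) : PSL2 := projSL (Cmat t)
def dpi : PSL2 := projSL Dmat

abbrev Xq (Γ : Subgroup PSL2) : Type := Quotient (QuotientGroup.rightRel Γ)

def xmk (Γ : Subgroup PSL2) (g : PSL2) : Xq Γ :=
  Quotient.mk (QuotientGroup.rightRel Γ) g

def flow (Γ : Subgroup PSL2) (t : ℝ) : Xq Γ → Xq Γ :=
  Quotient.lift (fun g => xmk Γ (g * aflow t)) (fun g h hgh => Quot.sound (by
    have h1 : h * g⁻¹ ∈ Γ := QuotientGroup.rightRel_apply.mp hgh
    refine QuotientGroup.rightRel_apply.mpr ?_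
    have heq : h * aflow t * (g * aflow t)⁻¹ = h * g⁻¹ := by group
    rw [heq]; exact h1))

def trev (Γ : Subgroup PSL2) : Xq Γ → Xq Γ :=
  Quotient.lift (fun g => xmk Γ (g * dpi)) (fun g h hgh => Quot.sound (by
    have h1 : h * g⁻¹ ∈ Γ := QuotientGroup.rightRel_apply.mp hgh
    refine QuotientGroup.rightRel_apply.mpr ?_
    have heq : h * dpi * (g * dpi)⁻¹ = h * g⁻¹ := by group
    rw [heq]; exact h1))

def dX (Γ : Subgroup PSL2) (dG : PSL2 → PSL2 → ℝ) (x y : Xq Γ) : ℝ :=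
  sInf {r : ℝ | ∃ g h : PSL2, xmk Γ g = x ∧ xmk Γ h = y ∧ dG g h = r}

def Psec (Γ : Subgroup PSL2) (ε : ℝ) (x : Xq Γ) : Set (Xq Γ) :=
  {y | ∃ (g : PSL2) (u s : ℝ), xmk Γ g = x ∧ |u| < ε ∧ |s| < ε ∧
        y = xmk Γ (g * chor u * bhor s)}

def Psec' (Γ : Subgroup PSL2) (ε : ℝ) (x : Xq Γ) : Set (Xq Γ) :=
  {y | ∃ (g : PSL2) (s u : ℝ), xmk Γ g = x ∧ |s| < ε ∧ |u| < ε ∧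
        y = xmk Γ (g * bhor s * chor u)}

def Wsloc (Γ : Subgroup PSL2) (ε : ℝ) (x : Xq Γ) : Set (Xq Γ) :=
  {y | ∃ (g : PSL2) (t : ℝ), xmk Γ g = x ∧ |t| < ε ∧ y = xmk Γ (g * bhor t)}

def Wuloc (Γ : Subgroup PSL2) (ε : ℝ) (x : Xq Γ) : Set (Xq Γ) :=
  {y | ∃ (g : PSL2) (t : ℝ), xmk Γ g = x ∧ |t| < ε ∧ y = xmk Γ (g * chor t)}

instance : TopologicalSpace SL2 :=
  TopologicalSpace.induced (fun A : SL2 => (A : Matrix (Fin 2) (Fin 2) ℝ)) inferInstance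

theorem bhor_mul_chor_injective {s u s' u' : ℝ}
    (h : bhor s * chor u = bhor s' * chor u') : s = s' ∧ u = u' := by
  have h1 : (Bmat s * Cmat u)⁻¹ * (Bmat s' * Cmat u') ∈ Subgroup.center SL2 :=
    QuotientGroup.eq.mp h
  obtain ⟨r, -, hr⟩ := Matrix.SpecialLinearGroup.mem_center_iff.mp h1
  have h2 : (Bmat s' * Cmat u' : SL2).1 = (Bmat s * Cmat u : SL2).1 * Matrix.scalar (Fin 2) r := by
    rw [hr, ← Matrix.SpecialLinearGroup.coe_mul, mul_inv_cancel_left]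
  rw [Matrix.SpecialLinearGroup.coe_mul, Matrix.SpecialLinearGroup.coe_mul] at h2
  have h01 := congrFun (congrFun h2 0) 1
  have h10 := congrFun (congrFun h2 1) 0
  have h11 := congrFun (congrFun h2 1) 1
  simp [Bmat, Cmat, Matrix.mul_apply, Fin.sum_univ_two] at h01 h10 h11
  subst h11
  constructor <;> linarith

theorem xmk_eq_iff {Γ : Subgroup PSL2} {g h : PSL2} : xmk Γ g = xmk Γ h ↔ h * g⁻¹ ∈ Γ :=
  Quotient.eq.trans QuotientGroup.rightRel_apply

theorem xmk_mul_right {Γ : Subgroup PSL2} {g h : PSL2} (hgh : xmk Γ g = xmk Γ h) (k : PSL2) :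
    xmk Γ (g * k) = xmk Γ (h * k) := by
  rw [xmk_eq_iff] at hgh ⊢
  simpa [mul_assoc] using hgh

theorem stmt_1
    (dG : PSL2 → PSL2 → ℝ)
    (hdG_self : ∀ g : PSL2, dG g g = 0)
    (hdG_sep : ∀ g h : PSL2, dG g h = 0 → g = h)
    (hdG_symm : ∀ g h : PSL2, dG g h = dG h g)
    (hdG_tri : ∀ g h k : PSL2, dG g k ≤ dG g h + dG h k)
    (hdG_left : ∀ k g h : PSL2, dG (k * g) (k * h) = dG g h)
    (hdG_b : ∀ s : ℝ, dG (bhor s) 1 ≤ |s|)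
    (hdG_c : ∀ u : ℝ, dG (chor u) 1 ≤ |u|)
    (hdG_a : ∀ τ : ℝ, dG (aflow τ) 1 ≤ |τ| / Real.sqrt 2)
    (Γ : Subgroup PSL2) (σ₀ : ℝ) (hσ₀ : 0 < σ₀)
    (hΓ : ∀ (g γ : PSL2), γ ∈ Γ → γ ≠ 1 → σ₀ ≤ dG g (γ * g))
    (hcomp : CompactSpace (Xq Γ))
    (ε : ℝ) (hε0 : 0 < ε) (hε : ε < σ₀ / 4) (x : Xq Γ) :
    ∀ y ∈ Psec' Γ ε x, ∃! p : ℝ × ℝ,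
        p.1 ∈ Set.Ioo (-ε) ε ∧ p.2 ∈ Set.Ioo (-ε) ε ∧
        ∀ g : PSL2, xmk Γ g = x → y = xmk Γ (g * bhor p.1 * chor p.2) := by
  rintro y ⟨g, s, u, hg, hs, hu, rfl⟩
  refine ⟨(s, u), ⟨abs_lt.mp hs, abs_lt.mp hu, fun g' hg' => ?_⟩, ?_⟩
  · rw [mul_assoc, mul_assoc]
    exact xmk_mul_right (hg.trans hg'.symm) _
  rintro ⟨s', u'⟩ ⟨hs', hu', h⟩
  replace hs' : |s'| < ε := abs_lt.mpr hs'
  replace hu' : |u'| < ε := abs_lt.mpr hu'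
  have hbound : ∀ a b : ℝ, dG (bhor a * chor b) 1 ≤ |a| + |b| := by
    intro a b
    have h1 := hdG_tri (bhor a * chor b) (bhor a) 1
    have h2 := hdG_left (bhor a) (chor b) 1
    rw [mul_one] at h2
    linarith [hdG_b a, hdG_c b]
  have hΓmem := xmk_eq_iff.mp (h g hg)
  set k := g * bhor s * chor u with hk
  set m := g * bhor s' * chor u' with hm
  have hdist : dG k m < σ₀ := by
    have h1 := hdG_left g (bhor s * chor u) (bhor s' * chor u')
    rw [← mul_assoc, ← mul_assoc, ← hk, ← hm] at h1
    have h2 := hdG_tri (bhor s * chor u) 1 (bhor s' * chor u')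
    rw [hdG_symm 1] at h2
    linarith [hbound s u, hbound s' u']
  have hkm : m * k⁻¹ = 1 := by
    by_contra hne
    have h1 := hΓ k _ hΓmem hne
    rw [inv_mul_cancel_right] at h1
    linarith
  have heq : g * (bhor s' * chor u') = g * (bhor s * chor u) := by
    rw [← mul_assoc, ← mul_assoc]
    exact mul_inv_eq_one.mp hkm
  obtain ⟨rfl, rfl⟩ := bhor_mul_chor_injective (mul_left_cancel heq)
  rfl
end
end

section
/- For every ρ > 0 there exists ε = ε(ρ) > 0 with the following property. If δ ∈ (0, σ₀/8) and x, x₁, x₂ ∈ X are such that x_i ∈ 𝒫_δ(x) with x_i = (u_i,s_i)_x for i = 1,2, then for any T > 0: (a) if d_X(φ_t(x₁),φ_t(x₂)) < ε for all t ∈ [0,T], then |u₁ − u₂| < ρ e^{−T}; (b) if d_X(φ_t(x₁),φ_t(x₂)) < ε for all t ∈ [−T,0], then |s₁ − s₂ − s₁s₂(u₁ − u₂)| < ρ e^{−T}; (c) if d_X(φ_t(x₁),φ_t(x₂)) < ε for all t ∈ [−T,T], then |u₁ − u₂| < ρ e^{−T} and |s₁ − s₂| < (3/2) ρ e^{−T}.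 -/
noncomputable section

open Real

/-- A length function on `SL2` controlled by the coordinates of `Amat`, `Bmat` and `Cmat`,
whose zeros are diagonal matrices. -/
structure IsLength (N : SL2 → ℝ) : Prop where
  mul_le : ∀ M M', N (M * M') ≤ N M + N M'
  inv_eq : ∀ M, N M⁻¹ = N M
  offDiag_eq_zero : ∀ M, N M = 0 → M 0 1 = 0 ∧ M 1 0 = 0
  Amat_le : ∀ t, N (Amat t) ≤ |t| / √2
  Bmat_le : ∀ t, N (Bmat t) ≤ |t|
  Cmat_le : ∀ t, N (Cmat t) ≤ |t|

theorem SL2.mul_sub_mul_eq_one (M : SL2) : M 0 0 * M 1 1 - M 0 1 * M 1 0 = 1 := by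
  have h := M.2
  rwa [Matrix.det_fin_two] at h

theorem SL2.mul_apply (M M' : SL2) (i j : Fin 2) :
    (M * M') i j = M i 0 * M' 0 j + M i 1 * M' 1 j := by
  rw [Matrix.SpecialLinearGroup.coe_mul, Matrix.mul_apply, Fin.sum_univ_two]

theorem Amat_coe (t : ℝ) :
    (Amat t : Matrix (Fin 2) (Fin 2) ℝ) = !![Real.exp (t / 2), 0; 0, Real.exp (-(t / 2))] := rfl

theorem Bmat_coe (t : ℝ) : (Bmat t : Matrix (Fin 2) (Fin 2) ℝ) = !![1, t; 0, 1] := rfl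

theorem Cmat_coe (t : ℝ) : (Cmat t : Matrix (Fin 2) (Fin 2) ℝ) = !![1, 0; t, 1] := rfl

theorem SL2.continuous_coe : Continuous (fun M : SL2 => (M : Matrix (Fin 2) (Fin 2) ℝ)) :=
  continuous_induced_dom

theorem SL2.isClosedEmbedding_coe :
    Topology.IsClosedEmbedding (fun M : SL2 => (M : Matrix (Fin 2) (Fin 2) ℝ)) := by
  refine ⟨⟨⟨rfl⟩, Subtype.val_injective⟩, ?_⟩
  have h : Set.range (fun M : SL2 => (M : Matrix (Fin 2) (Fin 2) ℝ)) = {A | A.det = 1} := by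
    ext A
    exact ⟨fun ⟨M, hM⟩ => hM ▸ M.2, fun hA => ⟨⟨A, hA⟩, rfl⟩⟩
  rw [h]
  exact isClosed_eq (continuous_id.matrix_det) continuous_const

/-- The unipotent matrix fixing the vector `(x, y)`. -/
def unip (p : ℝ × ℝ) : SL2 :=
  ⟨!![1 - p.1 * p.2, p.1 ^ 2; -p.2 ^ 2, 1 + p.1 * p.2], by
    rw [Matrix.det_fin_two_of]; ring⟩

theorem continuous_unip : Continuous unip := by
  refine continuous_induced_rng.2 ?_
  refine continuous_pi fun i => continuous_pi fun j => ?_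
  fin_cases i <;> fin_cases j <;> simp [unip] <;> fun_prop

theorem SL2.eq_Cmat_mul_Bmat_mul_Amat (M : SL2) (h : 0 < M 0 0) :
    M = Cmat (M 1 0 / M 0 0) * Bmat (M 0 1 * M 0 0) * Amat (2 * Real.log (M 0 0)) := by
  have hd := SL2.mul_sub_mul_eq_one M
  ext i j
  fin_cases i <;> fin_cases j <;>
    simp [SL2.mul_apply, Amat_coe, Bmat_coe, Cmat_coe, Real.exp_neg, Real.exp_log h] <;>
    field_simp
  linarith

namespace IsLength

variable {N : SL2 → ℝ}

theorem one_eq (hN : IsLength N) : N 1 = 0 := by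
  have h1 := hN.mul_le 1 1
  have h2 := hN.Bmat_le 0
  have h3 : Bmat 0 = 1 := by
    ext i j
    fin_cases i <;> fin_cases j <;> simp [Bmat]
  rw [h3] at h2
  simp only [mul_one, abs_zero] at h1 h2
  linarith

theorem nonneg (hN : IsLength N) (M : SL2) : 0 ≤ N M := by
  have h1 := hN.mul_le M M⁻¹
  rw [mul_inv_cancel, hN.one_eq, hN.inv_eq] at h1
  linarith

theorem le_of_pos (hN : IsLength N) (M : SL2) (h : 0 < M 0 0) :
    N M ≤ |M 1 0 / M 0 0| + |M 0 1 * M 0 0| + |2 * Real.log (M 0 0)| / √2 := by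
  conv_lhs => rw [SL2.eq_Cmat_mul_Bmat_mul_Amat M h]
  refine (hN.mul_le _ _).trans (add_le_add ((hN.mul_le _ _).trans (add_le_add ?_ ?_)) ?_)
  exacts [hN.Cmat_le _, hN.Bmat_le _, hN.Amat_le _]

theorem abs_sub_le (hN : IsLength N) (M M₀ : SL2) : |N M - N M₀| ≤ N (M₀⁻¹ * M) := by
  have h1 := hN.mul_le M₀ (M₀⁻¹ * M)
  have h2 := hN.mul_le M (M₀⁻¹ * M)⁻¹
  rw [hN.inv_eq] at h2
  rw [mul_inv_cancel_left] at h1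
  rw [mul_inv_rev, inv_inv, mul_inv_cancel_left] at h2
  rw [abs_le]
  constructor <;> linarith

theorem continuous (hN : IsLength N) : Continuous N := by
  rw [continuous_iff_continuousAt]
  intro M₀
  let q : SL2 → Matrix (Fin 2) (Fin 2) ℝ := fun M => (M₀⁻¹ * M : SL2)
  have hq : Continuous q := by
    have : q = fun M : SL2 =>
        ((M₀⁻¹ : SL2) : Matrix (Fin 2) (Fin 2) ℝ) * (M : Matrix (Fin 2) (Fin 2) ℝ) := by
      funext M
      exact Matrix.SpecialLinearGroup.coe_mul _ _
    rw [this]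
    exact continuous_const.matrix_mul SL2.continuous_coe
  have hq0 : q M₀ = 1 := by
    simp only [q, inv_mul_cancel, Matrix.SpecialLinearGroup.coe_one]
  have he : ∀ i j, Continuous fun M => q M i j := fun i j => hq.matrix_elem i j
  have hne : q M₀ 0 0 ≠ 0 := by simp [hq0]
  have hlim : ContinuousAt (fun M => |q M 1 0 / q M 0 0| + |q M 0 1 * q M 0 0| +
      |2 * Real.log (q M 0 0)| / √2) M₀ := by
    refine ContinuousAt.add (ContinuousAt.add ?_ ?_) ?_
    · exact ((he 1 0).continuousAt.div (he 0 0).continuousAt hne).abs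
    · exact ((he 0 1).continuousAt.mul (he 0 0).continuousAt).abs
    · exact ((continuousAt_const.mul ((he 0 0).continuousAt.log hne)).abs).div_const _
  have hlim' : Filter.Tendsto (fun M => |q M 1 0 / q M 0 0| + |q M 0 1 * q M 0 0| +
      |2 * Real.log (q M 0 0)| / √2) (nhds M₀) (nhds 0) := by
    have := hlim.tendsto
    simpa [hq0] using this
  have hpos : ∀ᶠ M in nhds M₀, 0 < q M 0 0 :=
    (he 0 0).continuousAt.eventually (lt_mem_nhds (by simp [hq0]))
  rw [ContinuousAt, tendsto_iff_dist_tendsto_zero]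
  refine squeeze_zero' (Filter.Eventually.of_forall fun _ => dist_nonneg) ?_ hlim'
  filter_upwards [hpos] with M hM
  rw [Real.dist_eq]
  exact (hN.abs_sub_le M M₀).trans (hN.le_of_pos _ hM)

theorem exists_pos_le (hN : IsLength N) {K : Set SL2} (hK : IsCompact K)
    (hK0 : ∀ M ∈ K, ¬ (M 0 1 = 0 ∧ M 1 0 = 0)) : ∃ η > 0, ∀ M ∈ K, η ≤ N M := by
  rcases K.eq_empty_or_nonempty with rfl | hne
  · exact ⟨1, one_pos, by simp⟩
  · obtain ⟨M, hM, hmin⟩ := hK.exists_isMinOn hne hN.continuous.continuousOn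
    exact ⟨N M, (hN.nonneg M).lt_of_ne fun h => hK0 M hM (hN.offDiag_eq_zero M h.symm),
      fun M' hM' => hmin hM'⟩

theorem exists_pos_le_unip (hN : IsLength N) :
    ∃ η > 0, ∀ p : ℝ × ℝ, p.1 ^ 2 + p.2 ^ 2 = 1 → η ≤ N (unip p) := by
  have hS : IsCompact {p : ℝ × ℝ | p.1 ^ 2 + p.2 ^ 2 = 1} := by
    refine (isCompact_Icc (a := ((-1, -1) : ℝ × ℝ)) (b := (1, 1))).of_isClosed_subset
      (isClosed_eq (by fun_prop) continuous_const) ?_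
    rintro ⟨x, y⟩ h
    simp only [Set.mem_ofPred_eq] at h
    simp only [Set.mem_Icc, Prod.mk_le_mk]
    refine ⟨⟨?_, ?_⟩, ?_, ?_⟩ <;> nlinarith [sq_nonneg x, sq_nonneg y]
  obtain ⟨η, hη, h⟩ := hN.exists_pos_le (hS.image continuous_unip) (by
    rintro _ ⟨⟨x, y⟩, hp, rfl⟩ ⟨h1, h2⟩
    simp [unip] at h1 h2 hp
    simp [h1, h2] at hp)
  exact ⟨η, hη, fun p hp => h _ ⟨p, hp, rfl⟩⟩

theorem le_of_conj (hN : IsLength N) {M P Q : SL2} (h : P * M = M * Q) :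
    N P ≤ 2 * N M + N Q := by
  have h1 : P = M * Q * M⁻¹ := by rw [← h, mul_inv_cancel_right]
  have h2 := hN.mul_le (M * Q) M⁻¹
  rw [← h1, hN.inv_eq] at h2
  linarith [hN.mul_le M Q]

/-- The entries of a matrix of small length are bounded. -/
theorem exists_bound (hN : IsLength N) :
    ∃ η > 0, ∃ R : ℝ, ∀ M : SL2, N M < η → ∀ i j, |M i j| ≤ R := by
  obtain ⟨η, hη, h⟩ := hN.exists_pos_le_unip
  refine ⟨η / 4, by positivity, √(2 / η), fun M hM => ?_⟩
  have hd := SL2.mul_sub_mul_eq_one M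
  have key : ∀ (x y : ℝ) (Q : SL2), x ^ 2 + y ^ 2 ≠ 0 → N Q ≤ (x ^ 2 + y ^ 2)⁻¹ →
      unip (x / √(x ^ 2 + y ^ 2), y / √(x ^ 2 + y ^ 2)) * M = M * Q →
      |x| ≤ √(2 / η) ∧ |y| ≤ √(2 / η) := by
    intro x y Q hr hQ hc
    have hr' : 0 < x ^ 2 + y ^ 2 := lt_of_le_of_ne (by positivity) hr.symm
    have h1 := h (x / √(x ^ 2 + y ^ 2), y / √(x ^ 2 + y ^ 2)) (by
      simp only [div_pow, Real.sq_sqrt hr'.le]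
      field_simp)
    have h2 := hN.le_of_conj hc
    have h3 : η / 2 < (x ^ 2 + y ^ 2)⁻¹ := by linarith
    have h4 : x ^ 2 + y ^ 2 ≤ 2 / η := by
      rw [lt_inv_comm₀ (by positivity) hr', inv_div] at h3
      exact h3.le
    constructor <;> apply Real.abs_le_sqrt <;> nlinarith [sq_nonneg x, sq_nonneg y]
  have hne : ∀ x y : ℝ, x ^ 2 + y ^ 2 = 0 → x = 0 ∧ y = 0 := fun x y h =>
    ⟨by nlinarith [sq_nonneg x, sq_nonneg y], by nlinarith [sq_nonneg x, sq_nonneg y]⟩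
  have conj : ∀ x y : ℝ, x ^ 2 + y ^ 2 ≠ 0 → ∀ Q : SL2,
      (!![x ^ 2 + y ^ 2 - x * y, x ^ 2; -y ^ 2, x ^ 2 + y ^ 2 + x * y] *
        (M : Matrix (Fin 2) (Fin 2) ℝ) = (x ^ 2 + y ^ 2) • ((M * Q : SL2) : Matrix _ _ ℝ)) →
      unip (x / √(x ^ 2 + y ^ 2), y / √(x ^ 2 + y ^ 2)) * M = M * Q := by
    intro x y hr Q hQ
    have hr' : 0 < x ^ 2 + y ^ 2 := lt_of_le_of_ne (by positivity) hr.symm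
    apply Subtype.val_injective
    have h5 : ((unip (x / √(x ^ 2 + y ^ 2), y / √(x ^ 2 + y ^ 2)) : SL2) : Matrix _ _ ℝ) =
        (x ^ 2 + y ^ 2)⁻¹ • !![x ^ 2 + y ^ 2 - x * y, x ^ 2; -y ^ 2, x ^ 2 + y ^ 2 + x * y] := by
      ext i j
      fin_cases i <;> fin_cases j <;>
        simp [unip, div_pow, div_mul_div_comm, Real.sq_sqrt hr'.le, ← sq] <;> field_simp
    change ((_ * _ : SL2) : Matrix (Fin 2) (Fin 2) ℝ) = _
    rw [Matrix.SpecialLinearGroup.coe_mul, h5, Matrix.smul_mul, hQ, smul_smul,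
      inv_mul_cancel₀ hr, one_smul]
  have hcol0 : |M 0 0| ≤ √(2 / η) ∧ |M 1 0| ≤ √(2 / η) := by
    have hr : M 0 0 ^ 2 + M 1 0 ^ 2 ≠ 0 := fun h0 => by
      obtain ⟨h1, h2⟩ := hne _ _ h0
      simp [h1, h2] at hd
    refine key _ _ (Bmat (M 0 0 ^ 2 + M 1 0 ^ 2)⁻¹) hr
      ((hN.Bmat_le _).trans_eq (abs_of_nonneg (by positivity))) (conj _ _ hr _ ?_)
    ext i j
    fin_cases i <;> fin_cases j <;>
      simp [Bmat_coe, Matrix.mul_apply, Fin.sum_univ_two]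
    · ring
    · field_simp
      linear_combination (M 0 0) * hd
    · ring
    · field_simp
      linear_combination (M 1 0) * hd
  have hcol1 : |M 0 1| ≤ √(2 / η) ∧ |M 1 1| ≤ √(2 / η) := by
    have hr : M 0 1 ^ 2 + M 1 1 ^ 2 ≠ 0 := fun h0 => by
      obtain ⟨h1, h2⟩ := hne _ _ h0
      simp [h1, h2] at hd
    refine key _ _ (Cmat (-(M 0 1 ^ 2 + M 1 1 ^ 2)⁻¹)) hr
      ((hN.Cmat_le _).trans_eq (by rw [abs_neg]; exact abs_of_nonneg (by positivity)))
      (conj _ _ hr _ ?_)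
    ext i j
    fin_cases i <;> fin_cases j <;>
      simp [Cmat_coe, Matrix.mul_apply, Fin.sum_univ_two]
    · field_simp
      linear_combination -(M 0 1) * hd
    · ring
    · field_simp
      linear_combination -(M 1 1) * hd
    · ring
  intro i j
  fin_cases i <;> fin_cases j
  exacts [hcol0.1, hcol1.1, hcol0.2, hcol1.2]

/-- A matrix of small length has small off-diagonal entries. -/
theorem exists_offDiag_lt (hN : IsLength N) {ρ : ℝ} (hρ : 0 < ρ) :
    ∃ ε > 0, ∀ M : SL2, N M < ε → |M 0 1| < ρ ∧ |M 1 0| < ρ := by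
  obtain ⟨η, hη, R, hR⟩ := hN.exists_bound
  let K : Set (Matrix (Fin 2) (Fin 2) ℝ) :=
    (Set.pi Set.univ fun _ => Set.pi Set.univ fun _ => Set.Icc (-R) R) ∩
      {A | ρ ≤ |A 0 1| ∨ ρ ≤ |A 1 0|}
  have hK : IsCompact K := by
    refine (isCompact_univ_pi fun _ => isCompact_univ_pi fun _ => isCompact_Icc).inter_right ?_
    exact (isClosed_le continuous_const (continuous_id.matrix_elem 0 1).abs).union
      (isClosed_le continuous_const (continuous_id.matrix_elem 1 0).abs)
  obtain ⟨η', hη', h⟩ := hN.exists_pos_le (SL2.isClosedEmbedding_coe.isCompact_preimage hK) (by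
    rintro M ⟨-, h⟩ ⟨h1, h2⟩
    simp only [Set.mem_ofPred_eq, h1, h2, abs_zero, or_self] at h
    linarith)
  refine ⟨min η η', lt_min hη hη', fun M hM => ?_⟩
  by_contra hcon
  rw [not_and_or, not_lt, not_lt] at hcon
  refine absurd (h M ⟨?_, hcon⟩) (not_le.2 (hM.trans_le (min_le_right _ _)))
  exact fun i _ j _ => abs_le.1 (hR M (hM.trans_le (min_le_left _ _)) i j)

end IsLength

theorem Amat_add (s t : ℝ) : Amat (s + t) = Amat s * Amat t := by
  ext i j
  fin_cases i <;> fin_cases j <;>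
    simp [SL2.mul_apply, Amat_coe, ← Real.exp_add] <;> ring

theorem aflow_add (s t : ℝ) : aflow (s + t) = aflow s * aflow t := by
  simp only [aflow, Amat_add, map_mul]

theorem aflow_zero : aflow 0 = 1 := by
  have h : Amat 0 = 1 := by
    ext i j
    fin_cases i <;> fin_cases j <;> simp [Amat_coe]
  rw [aflow, h, map_one]

theorem isLength_of_dist {dG : PSL2 → PSL2 → ℝ}
    (hdG_sep : ∀ g h : PSL2, dG g h = 0 → g = h)
    (hdG_symm : ∀ g h : PSL2, dG g h = dG h g)
    (hdG_tri : ∀ g h k : PSL2, dG g k ≤ dG g h + dG h k)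
    (hdG_left : ∀ k g h : PSL2, dG (k * g) (k * h) = dG g h)
    (hdG_b : ∀ s : ℝ, dG (bhor s) 1 ≤ |s|)
    (hdG_c : ∀ u : ℝ, dG (chor u) 1 ≤ |u|)
    (hdG_a : ∀ τ : ℝ, dG (aflow τ) 1 ≤ |τ| / √2) :
    IsLength fun M => dG (projSL M) 1 where
  mul_le M M' := by
    have h := hdG_left (projSL M) (projSL M') 1
    have h' := hdG_tri (projSL (M * M')) (projSL M) 1
    rw [mul_one, ← map_mul] at h
    linarith
  inv_eq M := by
    have h := hdG_left (projSL M) (projSL M⁻¹) 1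
    rw [map_inv, mul_inv_cancel, mul_one, hdG_symm] at h
    rw [map_inv, h]
  offDiag_eq_zero M h := by
    have h1 : M ∈ Subgroup.center SL2 := (QuotientGroup.eq_one_iff M).1 (hdG_sep _ _ h)
    obtain ⟨r, -, hr⟩ := Matrix.SpecialLinearGroup.mem_center_iff.1 h1
    simp [← hr]
  Amat_le := hdG_a
  Bmat_le := hdG_b
  Cmat_le := hdG_c

theorem exists_dist_lt_of_dX_lt {Γ : Subgroup PSL2} {dG : PSL2 → PSL2 → ℝ}
    (hdG_left : ∀ k g h : PSL2, dG (k * g) (k * h) = dG g h) {g h : PSL2} {ε : ℝ}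
    (hlt : dX Γ dG (xmk Γ g) (xmk Γ h) < ε) : ∃ γ ∈ Γ, dG g (γ * h) < ε := by
  have hne : {r : ℝ | ∃ g' h' : PSL2, xmk Γ g' = xmk Γ g ∧ xmk Γ h' = xmk Γ h ∧
      dG g' h' = r}.Nonempty := ⟨_, g, h, rfl, rfl, rfl⟩
  obtain ⟨_, ⟨g', h', hg, hh, rfl⟩, hr⟩ := exists_lt_of_csInf_lt hne hlt
  have hg' : g * g'⁻¹ ∈ Γ := QuotientGroup.rightRel_apply.1 (Quotient.exact hg)
  have hh' : h * h'⁻¹ ∈ Γ := QuotientGroup.rightRel_apply.1 (Quotient.exact hh)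
  refine ⟨g * g'⁻¹ * (h * h'⁻¹)⁻¹, Γ.mul_mem hg' (Γ.inv_mem hh'), ?_⟩
  rw [← hdG_left (g * g'⁻¹), inv_mul_cancel_right] at hr
  have e : g * g'⁻¹ * (h * h'⁻¹)⁻¹ * h = g * g'⁻¹ * h' := by group
  rwa [e]

/-- Points of the group that are closer than the injectivity scale realize the distance of their
projections. -/
theorem dist_lt_of_dX_lt {Γ : Subgroup PSL2} {dG : PSL2 → PSL2 → ℝ} {σ₀ : ℝ}
    (hdG_symm : ∀ g h : PSL2, dG g h = dG h g)
    (hdG_tri : ∀ g h k : PSL2, dG g k ≤ dG g h + dG h k)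
    (hdG_left : ∀ k g h : PSL2, dG (k * g) (k * h) = dG g h)
    (hΓ : ∀ g γ : PSL2, γ ∈ Γ → γ ≠ 1 → σ₀ ≤ dG g (γ * g)) {g h : PSL2} {ε : ℝ}
    (hlt : dX Γ dG (xmk Γ g) (xmk Γ h) < ε) (hgh : dG g h + ε ≤ σ₀) : dG g h < ε := by
  obtain ⟨γ, hγ, hr⟩ := exists_dist_lt_of_dX_lt hdG_left hlt
  by_cases h1 : γ = 1
  · rwa [h1, one_mul] at hr
  · have h2 := hΓ h γ hγ h1
    have h3 := hdG_tri h g (γ * h)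
    rw [hdG_symm h g] at h3
    linarith

theorem dist_mul_aflow_le {dG : PSL2 → PSL2 → ℝ}
    (hdG_symm : ∀ g h : PSL2, dG g h = dG h g)
    (hdG_tri : ∀ g h k : PSL2, dG g k ≤ dG g h + dG h k)
    (hdG_left : ∀ k g h : PSL2, dG (k * g) (k * h) = dG g h)
    (hdG_a : ∀ τ : ℝ, dG (aflow τ) 1 ≤ |τ| / √2) (g h : PSL2) (t : ℝ) :
    dG (g * aflow t) (h * aflow t) ≤ dG g h + 2 * |t| := by
  have ha : ∀ k, dG (k * aflow t) k ≤ |t| := fun k => by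
    have h1 := hdG_left k (aflow t) 1
    rw [mul_one] at h1
    rw [h1]
    exact (hdG_a t).trans (div_le_self (abs_nonneg t) (Real.one_le_sqrt.2 one_le_two))
  have h1 := hdG_tri (g * aflow t) g (h * aflow t)
  have h2 := hdG_tri g h (h * aflow t)
  rw [hdG_symm h] at h2
  linarith [ha g, ha h]

/-- Closeness of two orbits in the quotient lifts to the group. -/
theorem dist_mul_aflow_lt {Γ : Subgroup PSL2} {dG : PSL2 → PSL2 → ℝ} {σ₀ : ℝ} (hσ₀ : 0 < σ₀)
    (hdG_symm : ∀ g h : PSL2, dG g h = dG h g)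
    (hdG_tri : ∀ g h k : PSL2, dG g k ≤ dG g h + dG h k)
    (hdG_left : ∀ k g h : PSL2, dG (k * g) (k * h) = dG g h)
    (hdG_a : ∀ τ : ℝ, dG (aflow τ) 1 ≤ |τ| / √2)
    (hΓ : ∀ g γ : PSL2, γ ∈ Γ → γ ≠ 1 → σ₀ ≤ dG g (γ * g)) {g h : PSL2} {ε S : ℝ}
    (hε : ε ≤ σ₀ / 4) (hgh : dG g h ≤ σ₀ / 2)
    (hlt : ∀ θ ∈ Set.Icc (0 : ℝ) 1,
      dX Γ dG (flow Γ (θ * S) (xmk Γ g)) (flow Γ (θ * S) (xmk Γ h)) < ε) :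
    dG (g * aflow S) (h * aflow S) < ε := by
  obtain ⟨n, hn⟩ := exists_nat_gt (|S| / (σ₀ / 8))
  have hn0 : (0 : ℝ) < n := lt_of_le_of_lt (by positivity) hn
  have hstep : |S / n| ≤ σ₀ / 8 := by
    rw [div_lt_iff₀ (by positivity)] at hn
    rw [abs_div, abs_of_pos hn0, div_le_iff₀ hn0]
    linarith
  have key : ∀ k : ℕ, k ≤ n → dG (g * aflow (k / n * S)) (h * aflow (k / n * S)) < ε := by
    intro k
    induction k with
    | zero =>
      intro _
      have h0 := hlt 0 (by simp)
      refine dist_lt_of_dX_lt hdG_symm hdG_tri hdG_left hΓ (by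
        rw [Nat.cast_zero, zero_div]
        exact h0) ?_
      simp only [Nat.cast_zero, zero_div, zero_mul, aflow_zero, mul_one]
      linarith
    | succ k ih =>
      intro hk
      have h0 := hlt ((k + 1 : ℕ) / n)
        ⟨by positivity, (div_le_one hn0).2 (by exact_mod_cast hk)⟩
      refine dist_lt_of_dX_lt hdG_symm hdG_tri hdG_left hΓ h0 ?_
      have h1 : ((k + 1 : ℕ) : ℝ) / n * S = k / n * S + S / n := by
        push_cast
        ring
      rw [h1, aflow_add, ← mul_assoc, ← mul_assoc]
      have h2 := dist_mul_aflow_le hdG_symm hdG_tri hdG_left hdG_a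
        (g * aflow (k / n * S)) (h * aflow (k / n * S)) (S / n)
      linarith [ih (by omega)]
  have h1 := key n le_rfl
  rwa [div_self hn0.ne', one_mul] at h1

theorem dist_chor_mul_bhor_le {dG : PSL2 → PSL2 → ℝ}
    (hdG_symm : ∀ g h : PSL2, dG g h = dG h g)
    (hdG_tri : ∀ g h k : PSL2, dG g k ≤ dG g h + dG h k)
    (hdG_left : ∀ k g h : PSL2, dG (k * g) (k * h) = dG g h)
    (hdG_b : ∀ s : ℝ, dG (bhor s) 1 ≤ |s|)
    (hdG_c : ∀ u : ℝ, dG (chor u) 1 ≤ |u|) (g : PSL2) (u₁ s₁ u₂ s₂ : ℝ) :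
    dG (g * chor u₁ * bhor s₁) (g * chor u₂ * bhor s₂) ≤ |u₁| + |s₁| + (|u₂| + |s₂|) := by
  have key : ∀ u s : ℝ, dG (g * chor u * bhor s) g ≤ |u| + |s| := fun u s => by
    have h1 := hdG_left (g * chor u) (bhor s) 1
    have h2 := hdG_left g (chor u) 1
    have h3 := hdG_tri (g * chor u * bhor s) (g * chor u) g
    rw [mul_one] at h1 h2
    linarith [hdG_b s, hdG_c u]
  have h1 := hdG_tri (g * chor u₁ * bhor s₁) g (g * chor u₂ * bhor s₂)
  rw [hdG_symm g] at h1
  linarith [key u₁ s₁, key u₂ s₂]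

theorem SL2.inv_mul_apply (M' M : SL2) :
    (M'⁻¹ * M) 0 1 = M' 1 1 * M 0 1 - M' 0 1 * M 1 1 ∧
      (M'⁻¹ * M) 1 0 = M' 0 0 * M 1 0 - M' 1 0 * M 0 0 := by
  simp only [SL2.mul_apply, Matrix.SpecialLinearGroup.coe_inv,
    Matrix.adjugate_fin_two]
  constructor <;> simp <;> ring

theorem inv_mul_section_apply (u₁ s₁ u₂ s₂ S : ℝ) :
    ((Cmat u₂ * Bmat s₂ * Amat S)⁻¹ * (Cmat u₁ * Bmat s₁ * Amat S)) 0 1 =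
        (s₁ - s₂ - s₁ * s₂ * (u₁ - u₂)) * Real.exp (-S) ∧
      ((Cmat u₂ * Bmat s₂ * Amat S)⁻¹ * (Cmat u₁ * Bmat s₁ * Amat S)) 1 0 =
        (u₁ - u₂) * Real.exp S := by
  have h1 : Real.exp S = Real.exp (S / 2) * Real.exp (S / 2) := by
    rw [← Real.exp_add, add_halves]
  rw [(SL2.inv_mul_apply _ _).1, (SL2.inv_mul_apply _ _).2]
  simp [SL2.mul_apply, Amat_coe, Bmat_coe, Cmat_coe, Real.exp_neg, h1]
  constructor
  · field_simp
    ring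
  · field_simp

/-- The coordinates of two points of a Poincaré section whose orbits stay close up to time `S`. -/
theorem exists_section_coord_lt {dG : PSL2 → PSL2 → ℝ}
    (hdG_sep : ∀ g h : PSL2, dG g h = 0 → g = h)
    (hdG_symm : ∀ g h : PSL2, dG g h = dG h g)
    (hdG_tri : ∀ g h k : PSL2, dG g k ≤ dG g h + dG h k)
    (hdG_left : ∀ k g h : PSL2, dG (k * g) (k * h) = dG g h)
    (hdG_b : ∀ s : ℝ, dG (bhor s) 1 ≤ |s|)
    (hdG_c : ∀ u : ℝ, dG (chor u) 1 ≤ |u|)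
    (hdG_a : ∀ τ : ℝ, dG (aflow τ) 1 ≤ |τ| / √2)
    {Γ : Subgroup PSL2} {σ₀ : ℝ} (hσ₀ : 0 < σ₀)
    (hΓ : ∀ g γ : PSL2, γ ∈ Γ → γ ≠ 1 → σ₀ ≤ dG g (γ * g)) {ρ : ℝ} (hρ : 0 < ρ) :
    ∃ ε > 0, ∀ (g : PSL2) (u₁ s₁ u₂ s₂ : ℝ), |u₁| + |s₁| + (|u₂| + |s₂|) ≤ σ₀ / 2 → ∀ S : ℝ,
      (∀ θ ∈ Set.Icc (0 : ℝ) 1,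
        dX Γ dG (flow Γ (θ * S) (xmk Γ (g * chor u₁ * bhor s₁)))
          (flow Γ (θ * S) (xmk Γ (g * chor u₂ * bhor s₂))) < ε) →
      |s₁ - s₂ - s₁ * s₂ * (u₁ - u₂)| < ρ * Real.exp S ∧ |u₁ - u₂| < ρ * Real.exp (-S) := by
  obtain ⟨ε, hε, hN⟩ := (isLength_of_dist hdG_sep hdG_symm hdG_tri hdG_left hdG_b hdG_c
    hdG_a).exists_offDiag_lt hρ
  refine ⟨min ε (σ₀ / 4), lt_min hε (by positivity), fun g u₁ s₁ u₂ s₂ hsum S hlt => ?_⟩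
  have h1 := dist_mul_aflow_lt hσ₀ hdG_symm hdG_tri hdG_left hdG_a hΓ (min_le_right _ _)
    ((dist_chor_mul_bhor_le hdG_symm hdG_tri hdG_left hdG_b hdG_c g u₁ s₁ u₂ s₂).trans hsum) hlt
  have h2 : dG (projSL ((Cmat u₂ * Bmat s₂ * Amat S)⁻¹ * (Cmat u₁ * Bmat s₁ * Amat S))) 1 < ε := by
    rw [← hdG_left (g * chor u₂ * bhor s₂ * aflow S)]
    have e : g * chor u₂ * bhor s₂ * aflow S *
        projSL ((Cmat u₂ * Bmat s₂ * Amat S)⁻¹ * (Cmat u₁ * Bmat s₁ * Amat S)) =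
        g * chor u₁ * bhor s₁ * aflow S := by
      simp only [chor, bhor, aflow, map_mul, map_inv]
      group
    rw [e, mul_one]
    exact h1.trans_le (min_le_left _ _)
  obtain ⟨h3, h4⟩ := hN _ h2
  obtain ⟨e1, e2⟩ := inv_mul_section_apply u₁ s₁ u₂ s₂ S
  rw [e1, abs_mul, Real.abs_exp, ← lt_div_iff₀ (Real.exp_pos _), div_eq_mul_inv,
    ← Real.exp_neg, neg_neg] at h3
  rw [e2, abs_mul, Real.abs_exp, ← lt_div_iff₀ (Real.exp_pos _), div_eq_mul_inv,
    ← Real.exp_neg] at h4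
  exact ⟨h3, h4⟩

theorem stmt_2
    (dG : PSL2 → PSL2 → ℝ)
    (hdG_self : ∀ g : PSL2, dG g g = 0)
    (hdG_sep : ∀ g h : PSL2, dG g h = 0 → g = h)
    (hdG_symm : ∀ g h : PSL2, dG g h = dG h g)
    (hdG_tri : ∀ g h k : PSL2, dG g k ≤ dG g h + dG h k)
    (hdG_left : ∀ k g h : PSL2, dG (k * g) (k * h) = dG g h)
    (hdG_b : ∀ s : ℝ, dG (bhor s) 1 ≤ |s|)
    (hdG_c : ∀ u : ℝ, dG (chor u) 1 ≤ |u|)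
    (hdG_a : ∀ τ : ℝ, dG (aflow τ) 1 ≤ |τ| / Real.sqrt 2)
    (Γ : Subgroup PSL2) (σ₀ : ℝ) (hσ₀ : 0 < σ₀)
    (hΓ : ∀ (g γ : PSL2), γ ∈ Γ → γ ≠ 1 → σ₀ ≤ dG g (γ * g))
    (ρ : ℝ) (hρ : 0 < ρ) :
    ∃ ε : ℝ, 0 < ε ∧
      ∀ δ : ℝ, 0 < δ → δ < σ₀ / 8 →
        ∀ (g : PSL2) (u₁ s₁ u₂ s₂ : ℝ),
          |u₁| < δ → |s₁| < δ → |u₂| < δ → |s₂| < δ →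
          ∀ T : ℝ, 0 < T →
            ((∀ t ∈ Set.Icc (0:ℝ) T,
                dX Γ dG (flow Γ t (xmk Γ (g * chor u₁ * bhor s₁)))
                  (flow Γ t (xmk Γ (g * chor u₂ * bhor s₂))) < ε) →
              |u₁ - u₂| < ρ * Real.exp (-T)) ∧
            ((∀ t ∈ Set.Icc (-T) (0:ℝ),
                dX Γ dG (flow Γ t (xmk Γ (g * chor u₁ * bhor s₁)))
                  (flow Γ t (xmk Γ (g * chor u₂ * bhor s₂))) < ε) →
              |s₁ - s₂ - s₁ * s₂ * (u₁ - u₂)| < ρ * Real.exp (-T)) ∧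
            ((∀ t ∈ Set.Icc (-T) T,
                dX Γ dG (flow Γ t (xmk Γ (g * chor u₁ * bhor s₁)))
                  (flow Γ t (xmk Γ (g * chor u₂ * bhor s₂))) < ε) →
              |u₁ - u₂| < ρ * Real.exp (-T) ∧
              |s₁ - s₂| < 3 / 2 * ρ * Real.exp (-T)) := by
  have hρ' : 0 < ρ / (1 + σ₀ ^ 2) := by positivity
  have hρle : ρ / (1 + σ₀ ^ 2) ≤ ρ := div_le_self hρ.le (by nlinarith)
  obtain ⟨ε, hε, key⟩ := exists_section_coord_lt hdG_sep hdG_symm hdG_tri hdG_left hdG_b hdG_c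
    hdG_a hσ₀ hΓ hρ'
  refine ⟨ε, hε, fun δ _ hδσ g u₁ s₁ u₂ s₂ hu₁ hs₁ hu₂ hs₂ T hT => ?_⟩
  have key := key g u₁ s₁ u₂ s₂ (by linarith)
  have hexp := Real.exp_pos (-T)
  have forward (h : ∀ t ∈ Set.Icc (0 : ℝ) T,
      dX Γ dG (flow Γ t (xmk Γ (g * chor u₁ * bhor s₁)))
        (flow Γ t (xmk Γ (g * chor u₂ * bhor s₂))) < ε) :
      |u₁ - u₂| < ρ / (1 + σ₀ ^ 2) * Real.exp (-T) :=
    (key T fun θ hθ => h _ ⟨by nlinarith [hθ.1], by nlinarith [hθ.2]⟩).2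
  have backward (h : ∀ t ∈ Set.Icc (-T) (0 : ℝ),
      dX Γ dG (flow Γ t (xmk Γ (g * chor u₁ * bhor s₁)))
        (flow Γ t (xmk Γ (g * chor u₂ * bhor s₂))) < ε) :
      |s₁ - s₂ - s₁ * s₂ * (u₁ - u₂)| < ρ / (1 + σ₀ ^ 2) * Real.exp (-T) :=
    (key (-T) fun θ hθ => h _ ⟨by nlinarith [hθ.2], by nlinarith [hθ.1]⟩).1
  have hle : ρ / (1 + σ₀ ^ 2) * Real.exp (-T) ≤ ρ * Real.exp (-T) := by gcongr
  refine ⟨fun h => (forward h).trans_le hle, fun h => (backward h).trans_le hle, fun h => ?_⟩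
  have hu := forward fun t ht => h t ⟨by linarith [ht.1], ht.2⟩
  have hs := backward fun t ht => h t ⟨ht.1, by linarith [ht.2]⟩
  refine ⟨hu.trans_le hle, ?_⟩
  have hss : |s₁ * s₂| ≤ σ₀ ^ 2 := by
    rw [abs_mul, sq]
    exact mul_le_mul (by linarith) (by linarith) (abs_nonneg _) hσ₀.le
  calc |s₁ - s₂| = |(s₁ - s₂ - s₁ * s₂ * (u₁ - u₂)) + s₁ * s₂ * (u₁ - u₂)| := by ring_nf
    _ ≤ |s₁ - s₂ - s₁ * s₂ * (u₁ - u₂)| + |s₁ * s₂| * |u₁ - u₂| := by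
      rw [← abs_mul]
      exact abs_add_le _ _
    _ < ρ / (1 + σ₀ ^ 2) * Real.exp (-T) + σ₀ ^ 2 * (ρ / (1 + σ₀ ^ 2) * Real.exp (-T)) :=
      add_lt_add_of_lt_of_le hs (mul_le_mul hss hu.le (abs_nonneg _) (sq_nonneg _))
    _ = ρ * Real.exp (-T) := by field_simp
    _ ≤ 3 / 2 * ρ * Real.exp (-T) := by nlinarith [mul_pos hρ hexp]
end
end
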